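/- arXiv:1811.04121 — 2 statements merged into one kernel-verified Lean document; each statement's English description precedes it below -/
import Mathlib

section
/- Let z ~ N(0, I_n), let f : ℝⁿ → ℝⁿ be smooth with compact support and g : ℝⁿ → ℝ smooth with compact support. Then Var(zᵀ f(z) - div f(z) - g(z)) = E[‖f(z) - ∇g(z)‖² + tr((∇f(z))²)] + Var(g(z)) - E[‖∇g(z)‖²], and consequently Var(zᵀ f(z) - div f(z) - g(z)) ≤ E[‖f(z) - ∇g(z)‖² + tr((∇f(z))²)]. -/
open MeasureTheory ProbabilityTheory

namespace VIG

noncomputable abbrev gm (n : ℕ) : Measure (Fin n → ℝ) := Measure.pi fun _ : Fin n => gaussianReal 0 1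

noncomputable def dens (n : ℕ) (x : Fin n → ℝ) : ℝ := ∏ i, gaussianPDFReal 0 1 (x i)

noncomputable def pd {n : ℕ} (i : Fin n) (F : (Fin n → ℝ) → ℝ) (z : Fin n → ℝ) : ℝ :=
  fderiv ℝ F z (Pi.single i 1)

structure S {n : ℕ} (F : (Fin n → ℝ) → ℝ) : Prop where
  sm : ContDiff ℝ (⊤ : ℕ∞) F
  cs : HasCompactSupport F

lemma gm_eq (n : ℕ) : gm n = volume.withDensity (fun x => ENNReal.ofReal (dens n x)) := by
  refine Measure.pi_eq fun s hs => ?_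
  rw [withDensity_apply _ (MeasurableSet.univ_pi hs), ← lintegral_indicator (MeasurableSet.univ_pi hs)]
  have h1 : ∀ x : Fin n → ℝ, (Set.univ.pi s).indicator (fun x => ENNReal.ofReal (dens n x)) x
      = ENNReal.ofReal (∏ i, (s i).indicator (gaussianPDFReal 0 1) (x i)) := by
    intro x
    by_cases hx : x ∈ Set.univ.pi s
    · rw [Set.indicator_of_mem hx, dens]
      congr 1
      refine Finset.prod_congr rfl fun i _ => ?_
      rw [Set.indicator_of_mem (hx i (Set.mem_univ i))]
    · rw [Set.indicator_of_notMem hx]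
      simp only [Set.mem_pi, Set.mem_univ, true_imp_iff, not_forall] at hx
      obtain ⟨i, hi⟩ := hx
      rw [Finset.prod_eq_zero (Finset.mem_univ i) (Set.indicator_of_notMem hi _)]
      simp
  have hnn : ∀ i y, 0 ≤ (s i).indicator (gaussianPDFReal 0 1) y := fun i y =>
    Set.indicator_nonneg (fun _ _ => gaussianPDFReal_nonneg _ _ _) y
  simp_rw [h1]
  rw [← ofReal_integral_eq_lintegral_ofReal]
  · rw [integral_fintype_prod_volume_eq_prod (fun i => (s i).indicator (gaussianPDFReal 0 1)),
      ENNReal.ofReal_prod_of_nonneg (fun i _ => integral_nonneg (hnn i))]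
    refine Finset.prod_congr rfl fun i _ => ?_
    rw [integral_indicator (hs i), gaussianReal_apply_eq_integral _ one_ne_zero]
  · exact Integrable.fintype_prod (f := fun i => (s i).indicator (gaussianPDFReal 0 1))
      fun i => (integrable_gaussianPDFReal 0 1).indicator (hs i)
  · exact .of_forall fun x => Finset.prod_nonneg fun i _ => hnn i _

lemma contDiff_pdf : ContDiff ℝ (⊤ : ℕ∞) (gaussianPDFReal 0 1) := by
  rw [gaussianPDFReal_def]; fun_prop

lemma deriv_pdf (x : ℝ) : HasDerivAt (gaussianPDFReal 0 1) (-x * gaussianPDFReal 0 1 x) x := by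
  rw [gaussianPDFReal_def]
  have h : HasDerivAt (fun x : ℝ => -(x-0)^2 / (2 * ((1:NNReal):ℝ))) (-x) x := by
    have := (((hasDerivAt_id x).sub_const 0).pow 2).neg.div_const (2 * ((1:NNReal):ℝ))
    refine this.congr_deriv ?_
    simp
    ring
  refine (h.exp.const_mul ((√(2 * Real.pi * ((1:NNReal):ℝ)))⁻¹)).congr_deriv ?_
  ring

lemma contDiff_dens (n : ℕ) : ContDiff ℝ (⊤ : ℕ∞) (dens n) := by
  unfold dens
  exact contDiff_prod fun i _ => contDiff_pdf.comp (contDiff_apply ℝ ℝ i)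

lemma pd_dens {n : ℕ} (i : Fin n) (x) : pd i (dens n) x = - x i * dens n x := by
  have hd : HasFDerivAt (dens n) (fderiv ℝ (dens n) x) x :=
    ((contDiff_dens n).differentiable (by simp) x).hasFDerivAt
  have hl : HasDerivAt (fun t : ℝ => Function.update x i t) (Pi.single i 1) (x i) := hasDerivAt_update x i (x i)
  have hd' : HasFDerivAt (dens n) (fderiv ℝ (dens n) x) (Function.update x i (x i)) := by simpa using hd
  have h1 := hd'.comp_hasDerivAt (x i) hl
  have h2 : HasDerivAt (fun t : ℝ => gaussianPDFReal 0 1 t * ∏ j ∈ Finset.univ.erase i, gaussianPDFReal 0 1 (x j))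
     (-x i * gaussianPDFReal 0 1 (x i) * ∏ j ∈ Finset.univ.erase i, gaussianPDFReal 0 1 (x j)) (x i) :=
    (deriv_pdf (x i)).mul_const _
  have h3 : (dens n ∘ fun t : ℝ => Function.update x i t) = fun t : ℝ => gaussianPDFReal 0 1 t * ∏ j ∈ Finset.univ.erase i, gaussianPDFReal 0 1 (x j) := by
    funext t
    simp only [Function.comp, dens]
    rw [← Finset.mul_prod_erase _ _ (Finset.mem_univ i)]
    congr 1
    · simp
    · refine Finset.prod_congr rfl fun j hj => ?_
      rw [Function.update_of_ne (Finset.ne_of_mem_erase hj)]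
  rw [h3] at h1
  rw [pd, h1.unique h2, dens, ← Finset.mul_prod_erase _ _ (Finset.mem_univ i)]
  ring

lemma int_gm {n : ℕ} (F : (Fin n → ℝ) → ℝ) : ∫ x, F x ∂(gm n) = ∫ x, dens n x * F x := by
  rw [gm_eq, integral_withDensity_eq_integral_toReal_smul]
  · refine integral_congr_ae (.of_forall fun x => ?_)
    have : 0 ≤ dens n x := Finset.prod_nonneg fun i _ => gaussianPDFReal_nonneg _ _ _
    simp [ENNReal.toReal_ofReal this]
  · exact (contDiff_dens n).continuous.measurable.ennreal_ofReal
  · simp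

namespace S
variable {n : ℕ} {F G : (Fin n → ℝ) → ℝ}
lemma add (hF : S F) (hG : S G) : S (fun x => F x + G x) := ⟨hF.sm.add hG.sm, hF.cs.add hG.cs⟩
lemma neg (hF : S F) : S (fun x => - F x) := ⟨hF.sm.neg, hF.cs.neg⟩
lemma sub (hF : S F) (hG : S G) : S (fun x => F x - G x) := by
  simpa [sub_eq_add_neg] using hF.add hG.neg
lemma mulc (hF : S F) (hG : ContDiff ℝ (⊤ : ℕ∞) G) : S (fun x => F x * G x) := ⟨hF.sm.mul hG, hF.cs.mul_right⟩
lemma cmul (hF : S F) (hG : ContDiff ℝ (⊤ : ℕ∞) G) : S (fun x => G x * F x) := ⟨hG.mul hF.sm, hF.cs.mul_left⟩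
lemma mul (hF : S F) (hG : S G) : S (fun x => F x * G x) := hF.mulc hG.sm
lemma coord (hF : S F) (i : Fin n) : S (fun x => x i * F x) := hF.cmul (contDiff_apply ℝ ℝ i)
lemma pow (hF : S F) : S (fun x => F x ^ 2) := by simpa [sq] using hF.mul hF
lemma pd (hF : S F) (i : Fin n) : S (fun z => pd i F z) :=
  ⟨(hF.sm.fderiv_right (m := (⊤ : ℕ∞)) (by simp)).clm_apply contDiff_const, hF.cs.fderiv_apply ℝ _⟩
lemma zero : S (fun _ : Fin n → ℝ => (0:ℝ)) := ⟨contDiff_const, HasCompactSupport.zero⟩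
lemma sum {ι : Type*} (s : Finset ι) {F : ι → (Fin n → ℝ) → ℝ} (h : ∀ i, S (F i)) : S (fun x => ∑ i ∈ s, F i x) := by
  classical
  induction s using Finset.induction with
  | empty => simpa using zero
  | insert a s ha ih => simp_rw [Finset.sum_insert ha]; exact (h a).add ih
lemma int (hF : S F) : Integrable F (gm n) := hF.sm.continuous.integrable_of_hasCompactSupport hF.cs
lemma intv (hF : S F) : Integrable F volume := hF.sm.continuous.integrable_of_hasCompactSupport hF.cs
lemma diff (hF : S F) : Differentiable ℝ F := hF.sm.differentiable (by simp)
end S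

lemma stein {n : ℕ} {F : (Fin n → ℝ) → ℝ} (hF : S F) (i : Fin n) :
    ∫ x, x i * F x ∂(gm n) = ∫ x, pd i F x ∂(gm n) := by
  rw [int_gm, int_gm]
  have h := integral_mul_fderiv_eq_neg_fderiv_mul_of_integrable (μ := (volume : Measure (Fin n → ℝ)))
    (f := dens n) (g := F) (v := Pi.single i 1) ?_ ?_ ?_ ?_ ?_
  · change _ = ∫ x, dens n x * fderiv ℝ F x (Pi.single i 1)
    rw [h, ← integral_neg]
    refine integral_congr_ae (.of_forall fun x => ?_)
    have := pd_dens i x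
    simp only [pd] at this
    simp only [this]; ring
  · have : (fun x => fderiv ℝ (dens n) x (Pi.single i 1) * F x) = fun x => (-(x i * F x)) * dens n x := by
      funext x
      have := pd_dens i x
      simp only [pd] at this
      simp only [this]; ring
    rw [this]
    exact ((hF.coord i).neg.mulc (contDiff_dens n)).intv
  · exact ((hF.pd i).cmul (contDiff_dens n)).intv
  · exact (hF.cmul (contDiff_dens n)).intv
  · intro x _; exact (contDiff_dens n).differentiable (by simp) x
  · intro x _; exact hF.diff x

lemma pd_mul {n : ℕ} {F G : (Fin n → ℝ) → ℝ} (hF : Differentiable ℝ F) (hG : Differentiable ℝ G) (i : Fin n) (x) :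
    pd i (fun x => F x * G x) x = pd i F x * G x + F x * pd i G x := by
  simp only [pd]
  rw [fderiv_fun_mul (hF x) (hG x)]
  simp; ring

lemma stein2 {n : ℕ} {F G : (Fin n → ℝ) → ℝ} (hF : S F) (hG : S G) (i : Fin n) :
    ∫ x, (x i * F x - pd i F x) * G x ∂(gm n) = ∫ x, F x * pd i G x ∂(gm n) := by
  have h := stein (hF.mul hG) i
  simp_rw [pd_mul hF.diff hG.diff] at h
  rw [integral_add ((hF.pd i).mul hG).int (hF.mul (hG.pd i)).int] at h
  have : ∀ x : Fin n → ℝ, (x i * F x - pd i F x) * G x = x i * (F x * G x) - pd i F x * G x := fun x => by ring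
  simp_rw [this]
  rw [integral_sub ((hF.mul hG).coord i).int ((hF.pd i).mul hG).int, h]
  ring

/-- divergence -/
noncomputable def dl {n : ℕ} (f : Fin n → (Fin n → ℝ) → ℝ) (z : Fin n → ℝ) : ℝ :=
  ∑ i, (z i * f i z - pd i (f i) z)

lemma S.dl {n : ℕ} {f : Fin n → (Fin n → ℝ) → ℝ} (hf : ∀ i, S (f i)) : S (fun z => dl f z) :=
  S.sum _ fun i => ((hf i).coord i).sub ((hf i).pd i)

lemma dl_mean {n : ℕ} {f : Fin n → (Fin n → ℝ) → ℝ} (hf : ∀ i, S (f i)) : ∫ z, dl f z ∂(gm n) = 0 := by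
  simp only [dl]
  rw [integral_finsetSum _ fun i _ => (((hf i).coord i).sub ((hf i).pd i)).int]
  refine Finset.sum_eq_zero fun i _ => ?_
  rw [integral_sub ((hf i).coord i).int ((hf i).pd i).int, stein (hf i), sub_self]

lemma dl_mul {n : ℕ} {f : Fin n → (Fin n → ℝ) → ℝ} (hf : ∀ i, S (f i)) {g : (Fin n → ℝ) → ℝ} (hg : S g) :
    ∫ z, dl f z * g z ∂(gm n) = ∑ i, ∫ z, f i z * pd i g z ∂(gm n) := by
  simp only [dl, Finset.sum_mul]
  rw [integral_finsetSum _ fun i _ => ((((hf i).coord i).sub ((hf i).pd i)).mul hg).int]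
  exact Finset.sum_congr rfl fun i _ => stein2 (hf i) hg i

lemma pd_comm {n : ℕ} {F : (Fin n → ℝ) → ℝ} (hF : S F) (i j : Fin n) (x) :
    pd i (fun z => pd j F z) x = pd j (fun z => pd i F z) x := by
  have hd : DifferentiableAt ℝ (fderiv ℝ F) x :=
    (hF.sm.fderiv_right (m := (⊤ : ℕ∞)) (by simp)).differentiable (by simp) x
  have hs : IsSymmSndFDerivAt ℝ F x := hF.sm.contDiffAt.isSymmSndFDerivAt (by simp; exact WithTop.coe_le_coe.2 (le_top : (2:ℕ∞) ≤ ⊤))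
  have : ∀ i j : Fin n, pd i (fun z => pd j F z) x = fderiv ℝ (fderiv ℝ F) x (Pi.single i 1) (Pi.single j 1) := by
    intro i j
    simp only [pd]
    rw [fderiv_clm_apply hd (by fun_prop)]
    simp
  rw [this, this, hs.eq]

lemma pd_dl {n : ℕ} {f : Fin n → (Fin n → ℝ) → ℝ} (hf : ∀ i, S (f i)) (i : Fin n) (x) :
    pd i (fun z => dl f z) x = f i x + ∑ j, (x j * pd i (f j) x - pd j (fun z => pd i (f j) z) x) := by
  have h1 : ∀ j, pd i (fun z => z j * f j z - pd j (f j) z) x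
      = (Pi.single i (1:ℝ) : Fin n → ℝ) j * f j x + (x j * pd i (f j) x - pd j (fun z => pd i (f j) z) x) := by
    intro j
    have hc : Differentiable ℝ (fun z : Fin n → ℝ => z j) := by fun_prop
    have : pd i (fun z => z j * f j z - pd j (f j) z) x = pd i (fun z => z j * f j z) x - pd i (fun z => pd j (f j) z) x := by
      rw [pd, fderiv_fun_sub ((hf j).coord j |>.diff x) ((hf j).pd j |>.diff x)]
      simp [pd]
    rw [this, pd_comm (hf j), pd_mul hc (hf j).diff]
    have h2 : pd i (fun z : Fin n → ℝ => z j) x = (Pi.single i (1:ℝ) : Fin n → ℝ) j := by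
      simp only [pd]
      rw [fderiv_apply (hΦ := differentiableAt_fun_id)]; simp
    rw [h2]; ring
  have h0 : pd i (fun z => dl f z) x = ∑ j, pd i (fun z => z j * f j z - pd j (f j) z) x := by
    simp only [dl]
    rw [pd, fderiv_fun_sum fun j _ => (((hf j).coord j).sub ((hf j).pd j)).diff x]
    simp [pd]
  rw [h0]
  simp_rw [h1]
  rw [Finset.sum_add_distrib]
  congr 1
  simp [Pi.single_apply]

lemma dl_sq {n : ℕ} {f : Fin n → (Fin n → ℝ) → ℝ} (hf : ∀ i, S (f i)) :
    ∫ z, dl f z ^ 2 ∂(gm n) = ∑ i, (∫ z, f i z ^ 2 ∂(gm n) +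
      ∑ j, ∫ z, pd j (f i) z * pd i (f j) z ∂(gm n)) := by
  simp_rw [sq, dl_mul hf (S.dl hf), pd_dl hf]
  refine Finset.sum_congr rfl fun i _ => ?_
  simp_rw [mul_add, Finset.mul_sum]
  have hS : ∀ j, S (fun z => z j * pd i (f j) z - pd j (fun z => pd i (f j) z) z) := fun j =>
    (((hf j).pd i).coord j).sub (((hf j).pd i).pd j)
  rw [integral_add ((hf i).mul (hf i)).int (S.sum _ fun j => (hf i).mul (hS j)).int,
    integral_finsetSum _ fun j _ => ((hf i).mul (hS j)).int]
  congr 1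
  refine Finset.sum_congr rfl fun j _ => ?_
  have := stein2 ((hf j).pd i) (hf i) j
  calc _ = _ := by simp_rw [mul_comm (f i _)]
    _ = _ := this
    _ = _ := by simp_rw [mul_comm (pd i (f j) _)]

lemma var_eq {n : ℕ} {F : (Fin n → ℝ) → ℝ} (hF : S F) :
    ∫ z, (F z - ∫ w, F w ∂(gm n)) ^ 2 ∂(gm n) = ∫ z, F z ^ 2 ∂(gm n) - (∫ z, F z ∂(gm n)) ^ 2 := by
  set m := ∫ w, F w ∂(gm n)
  have : ∀ z, (F z - m) ^ 2 = (F z ^ 2 - F z * (2 * m)) + m ^ 2 := fun z => by ring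
  simp_rw [this]
  have hi : Integrable (fun z => F z ^ 2 - F z * (2 * m)) (gm n) := hF.pow.int.sub (hF.int.mul_const _)
  rw [integral_add hi (integrable_const _), integral_sub hF.pow.int (hF.int.mul_const _), integral_mul_const]
  simp
  ring

lemma ident {n : ℕ} {f : Fin n → (Fin n → ℝ) → ℝ} (hf : ∀ i, S (f i)) {g : (Fin n → ℝ) → ℝ} (hg : S g) :
    (∫ z, ((dl f z - g z) - ∫ w, (dl f w - g w) ∂(gm n)) ^ 2 ∂(gm n)) =
      (∫ z, ((∑ i, (f i z - pd i g z) ^ 2) + ∑ i, ∑ j, pd j (f i) z * pd i (f j) z) ∂(gm n))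
      + ((∫ z, (g z - ∫ w, g w ∂(gm n)) ^ 2 ∂(gm n)) - ∫ z, ∑ i, (pd i g z) ^ 2 ∂(gm n)) := by
  rw [var_eq ((S.dl hf).sub hg), var_eq hg, integral_sub (S.dl hf).int hg.int, dl_mean hf]
  have h1 : ∀ z, (dl f z - g z) ^ 2 = dl f z ^ 2 - 2 * (dl f z * g z) + g z ^ 2 := fun z => by ring
  simp_rw [h1]
  have hi := ((S.dl hf).mul hg).int
  have hi2 : Integrable (fun z => dl f z ^ 2 - 2 * (dl f z * g z)) (gm n) := (S.dl hf).pow.int.sub (hi.const_mul 2)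
  rw [integral_add hi2 hg.pow.int,
    integral_sub (S.dl hf).pow.int (hi.const_mul 2), integral_const_mul, dl_sq hf, dl_mul hf hg]
  have hS1 : ∀ i, S (fun z => (f i z - pd i g z) ^ 2) := fun i => ((hf i).sub (hg.pd i)).pow
  have hS2 : ∀ i, S (fun z => ∑ j, pd j (f i) z * pd i (f j) z) := fun i =>
    S.sum _ fun j => ((hf i).pd j).mul ((hf j).pd i)
  rw [integral_add (S.sum _ hS1).int (S.sum _ hS2).int,
    integral_finsetSum _ fun i _ => (hS1 i).int, integral_finsetSum _ fun i _ => (hS2 i).int,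
    integral_finsetSum _ fun i _ => ((hg.pd i).pow).int]
  have h2 : ∀ i, ∫ z, (f i z - pd i g z) ^ 2 ∂(gm n) = ∫ z, f i z ^ 2 ∂(gm n) - 2 * ∫ z, f i z * pd i g z ∂(gm n) + ∫ z, pd i g z ^ 2 ∂(gm n) := by
    intro i
    have h1 : ∀ z, (f i z - pd i g z) ^ 2 = f i z ^ 2 - 2 * (f i z * pd i g z) + pd i g z ^ 2 := fun z => by ring
    simp_rw [h1]
    have hi := ((hf i).mul (hg.pd i)).int
    have hi2 : Integrable (fun z => f i z ^ 2 - 2 * (f i z * pd i g z)) (gm n) := (hf i).pow.int.sub (hi.const_mul 2)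
    rw [integral_add hi2 (hg.pd i).pow.int,
      integral_sub (hf i).pow.int (hi.const_mul 2), integral_const_mul]
  have h3 : ∀ i, ∫ z, ∑ j, pd j (f i) z * pd i (f j) z ∂(gm n) = ∑ j, ∫ z, pd j (f i) z * pd i (f j) z ∂(gm n) := fun i =>
    integral_finsetSum _ fun j _ => (((hf i).pd j).mul ((hf j).pd i)).int
  simp_rw [h2, h3, Finset.sum_add_distrib, Finset.sum_sub_distrib, ← Finset.mul_sum]
  ring


/-! ### Poincare -/

noncomputable abbrev gm2 (n : ℕ) : Measure ((Fin n → ℝ) × (Fin n → ℝ)) := (gm n).prod (gm n)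

lemma rot1 (c s : ℝ) (h : c ^ 2 + s ^ 2 = 1) :
    ((gaussianReal 0 1).prod (gaussianReal 0 1)).map (fun p : ℝ × ℝ => c * p.1 + s * p.2) = gaussianReal 0 1 := by
  have hX : ((gaussianReal 0 1).prod (gaussianReal 0 1)).map (fun p : ℝ × ℝ => c * p.1) = gaussianReal 0 (NNReal.mk (c ^ 2) (sq_nonneg c)) := by
    have : (fun p : ℝ × ℝ => c * p.1) = (fun x => c * x) ∘ Prod.fst := rfl
    rw [this, ← Measure.map_map (by fun_prop) (by fun_prop), Measure.map_fst_prod]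
    simp [gaussianReal_map_const_mul]
  have hY : ((gaussianReal 0 1).prod (gaussianReal 0 1)).map (fun p : ℝ × ℝ => s * p.2) = gaussianReal 0 (NNReal.mk (s ^ 2) (sq_nonneg s)) := by
    have : (fun p : ℝ × ℝ => s * p.2) = (fun x => s * x) ∘ Prod.snd := rfl
    rw [this, ← Measure.map_map (by fun_prop) (by fun_prop), Measure.map_snd_prod]
    simp [gaussianReal_map_const_mul]
  have hI : IndepFun (fun p : ℝ × ℝ => c * p.1) (fun p : ℝ × ℝ => s * p.2) ((gaussianReal 0 1).prod (gaussianReal 0 1)) :=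
    indepFun_prod (X := fun x : ℝ => c * x) (Y := fun x : ℝ => s * x) (by fun_prop) (by fun_prop)
  have := gaussianReal_add_gaussianReal_of_indepFun hI hX hY
  have e : ((NNReal.mk (c ^ 2) (sq_nonneg c)) + (NNReal.mk (s ^ 2) (sq_nonneg s)) : NNReal) = 1 := by
    ext; simpa using h
  rw [e, add_zero] at this
  exact this

lemma rot (n : ℕ) (c s : ℝ) (h : c ^ 2 + s ^ 2 = 1) :
    (gm2 n).map (fun p => c • p.1 + s • p.2) = gm n := by
  have h1 := (measurePreserving_arrowProdEquivProdArrow ℝ ℝ (Fin n) (fun _ => gaussianReal 0 1)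
    (fun _ => gaussianReal 0 1)).map_eq
  rw [gm2, ← h1, Measure.map_map (by fun_prop) (MeasurableEquiv.measurable _)]
  have h2 : ((fun p : (Fin n → ℝ) × (Fin n → ℝ) => c • p.1 + s • p.2) ∘ (MeasurableEquiv.arrowProdEquivProdArrow ℝ ℝ (Fin n)))
    = fun x i => c * (x i).1 + s * (x i).2 := by
    funext x; ext i; rfl
  rw [h2]
  have : ∀ i : Fin n, SigmaFinite (((gaussianReal 0 1).prod (gaussianReal 0 1)).map (fun p : ℝ × ℝ => c * p.1 + s * p.2)) := by
    intro i; rw [rot1 c s h]; infer_instance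
  rw [Measure.pi_map_pi (f := fun _ : Fin n => fun p : ℝ × ℝ => c * p.1 + s * p.2) (fun i => by fun_prop)]
  simp_rw [rot1 c s h]

lemma int_rot {n : ℕ} {F : (Fin n → ℝ) → ℝ} (hF : Continuous F) (c s : ℝ) (h : c ^ 2 + s ^ 2 = 1) :
    ∫ p, F (c • p.1 + s • p.2) ∂(gm2 n) = ∫ x, F x ∂(gm n) := by
  rw [← rot n c s h, integral_map (by fun_prop) hF.aestronglyMeasurable]

lemma int_fst {n : ℕ} {F : (Fin n → ℝ) → ℝ} (hF : Continuous F) :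
    ∫ p, F p.1 ∂(gm2 n) = ∫ x, F x ∂(gm n) := by
  simpa using int_rot hF 1 0 (by simp)

lemma S.bdd {n : ℕ} {F : (Fin n → ℝ) → ℝ} (hF : S F) : ∃ C, 0 ≤ C ∧ ∀ x, |F x| ≤ C := by
  obtain ⟨C, hC⟩ := hF.sm.continuous.bounded_above_of_compact_support hF.cs
  exact ⟨C, (norm_nonneg _).trans (hC 0), hC⟩

lemma intg_coord {n : ℕ} (i : Fin n) : Integrable (fun x : Fin n → ℝ => x i) (gm n) := by
  have h : Integrable (fun x : ℝ => x) (gaussianReal 0 1) :=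
    (memLp_id_gaussianReal 1).integrable le_rfl
  exact (measurePreserving_eval (fun _ : Fin n => gaussianReal 0 1) i).integrable_comp_of_integrable h

lemma intg_fst {n : ℕ} (i : Fin n) : Integrable (fun p : (Fin n → ℝ) × (Fin n → ℝ) => p.1 i) (gm2 n) :=
  (intg_coord i).comp_fst (gm n)

lemma intg_snd {n : ℕ} (i : Fin n) : Integrable (fun p : (Fin n → ℝ) × (Fin n → ℝ) => p.2 i) (gm2 n) :=
  (intg_coord i).comp_snd (gm n)

/-- g(x) h(cx+sy) is integrable, as are coordinate multiples. -/
lemma intg_k {n : ℕ} {g h : (Fin n → ℝ) → ℝ} (hg : S g) (hh : S h) (c s : ℝ)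
    {k : (Fin n → ℝ) × (Fin n → ℝ) → ℝ} (hk : Integrable k (gm2 n)) :
    Integrable (fun p => k p * (g p.1 * h (c • p.1 + s • p.2))) (gm2 n) := by
  obtain ⟨C, hC0, hC⟩ := hg.bdd
  obtain ⟨D, hD0, hD⟩ := hh.bdd
  have := hg.sm.continuous
  have := hh.sm.continuous
  refine hk.mul_bdd (c := C * D) (Continuous.aestronglyMeasurable (by fun_prop)) (.of_forall fun p => ?_)
  rw [norm_mul]
  exact mul_le_mul (hC _) (hD _) (norm_nonneg _) hC0

lemma intg_1 {n : ℕ} {g h : (Fin n → ℝ) → ℝ} (hg : S g) (hh : S h) (c s : ℝ) :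
    Integrable (fun p => g p.1 * h (c • p.1 + s • p.2)) (gm2 n) := by
  simpa using intg_k hg hh c s (k := fun _ => 1) (integrable_const _)

lemma pd_aff {n : ℕ} {h : (Fin n → ℝ) → ℝ} (hh : S h) (c : ℝ) (w) (i : Fin n) (x) :
    pd i (fun x => h (c • x + w)) x = c * pd i h (c • x + w) := by
  have h1 : HasFDerivAt (fun x : Fin n → ℝ => c • x + w) (c • ContinuousLinearMap.id ℝ (Fin n → ℝ)) x :=
    ((hasFDerivAt_id x).const_smul c).add_const w
  have h2 := (hh.diff (c • x + w)).hasFDerivAt.comp x h1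
  have h3 : fderiv ℝ (fun x => h (c • x + w)) x = _ := h2.fderiv
  rw [pd, h3]
  simp [pd]

lemma S_aff {n : ℕ} {h : (Fin n → ℝ) → ℝ} (hh : S h) {c : ℝ} (hc : c ≠ 0) (w) :
    S (fun x => h (c • x + w)) :=
  ⟨hh.sm.comp ((contDiff_id.const_smul c).add contDiff_const),
   hh.cs.comp_homeomorph ((Homeomorph.smulOfNeZero c hc).trans (Homeomorph.addRight w))⟩

lemma cd_aff {n : ℕ} {h : (Fin n → ℝ) → ℝ} (hh : S h) (c : ℝ) (w) :
    ContDiff ℝ (⊤ : ℕ∞) (fun x => h (c • x + w)) :=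
  hh.sm.comp ((contDiff_id.const_smul c).add contDiff_const)

lemma ibp_fst {n : ℕ} {g h : (Fin n → ℝ) → ℝ} (hg : S g) (hh : S h) (c s : ℝ) (i : Fin n) :
    ∫ p, p.1 i * (g p.1 * h (c • p.1 + s • p.2)) ∂(gm2 n) =
      ∫ p, pd i g p.1 * h (c • p.1 + s • p.2) ∂(gm2 n) + c * ∫ p, g p.1 * pd i h (c • p.1 + s • p.2) ∂(gm2 n) := by
  have I1 := intg_1 (hg.pd i) hh c s
  have I2 := (intg_1 hg (hh.pd i) c s).const_mul c
  have I3 : Integrable (fun p => pd i g p.1 * h (c • p.1 + s • p.2) + c * (g p.1 * pd i h (c • p.1 + s • p.2))) (gm2 n) := I1.add I2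
  rw [← integral_const_mul, ← integral_add I1 I2, integral_prod_symm _ (intg_k hg hh c s (intg_fst i)),
    integral_prod_symm _ I3]
  refine integral_congr_ae (.of_forall fun y => ?_)
  have := stein (hg.mulc (cd_aff hh c (s • y))) i
  refine this.trans (integral_congr_ae (.of_forall fun x => ?_))
  simp only
  rw [pd_mul hg.diff ((cd_aff hh c (s • y)).differentiable (by simp)), pd_aff hh]
  ring

lemma ibp_snd {n : ℕ} {g h : (Fin n → ℝ) → ℝ} (hg : S g) (hh : S h) (c : ℝ) {s : ℝ} (hs : s ≠ 0) (i : Fin n) :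
    ∫ p, p.2 i * (g p.1 * h (c • p.1 + s • p.2)) ∂(gm2 n) =
      s * ∫ p, g p.1 * pd i h (c • p.1 + s • p.2) ∂(gm2 n) := by
  have I2 := (intg_1 hg (hh.pd i) c s).const_mul s
  rw [← integral_const_mul, integral_prod _ (intg_k hg hh c s (intg_snd i)), integral_prod _ I2]
  refine integral_congr_ae (.of_forall fun x => ?_)
  have := stein (S_aff hh hs (c • x)) i
  simp_rw [pd_aff hh, add_comm _ (c • x)] at this
  simp only
  calc _ = g x * ∫ y, y i * h (c • x + s • y) ∂(gm n) := by
        rw [← integral_const_mul]; congr 1; funext y; ring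
    _ = _ := by rw [this, ← integral_const_mul]; congr 1; funext y; ring

lemma cs_bound {n : ℕ} {h : (Fin n → ℝ) → ℝ} (hh : S h) (c s : ℝ) (hcs : c ^ 2 + s ^ 2 = 1) :
    ∫ p, h p.1 * h (c • p.1 + s • p.2) ∂(gm2 n) ≤ ∫ x, h x ^ 2 ∂(gm n) := by
  have hc := hh.sm.continuous
  have hsq : Continuous (fun x => h x ^ 2) := by fun_prop
  have J1 : Integrable (fun p : (Fin n → ℝ) × (Fin n → ℝ) => h p.1 ^ 2) (gm2 n) := hh.pow.int.comp_fst (gm n)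
  have J2 : Integrable (fun p : (Fin n → ℝ) × (Fin n → ℝ) => h (c • p.1 + s • p.2) ^ 2) (gm2 n) := by
    have := hh.pow.int
    rw [← rot n c s hcs] at this
    exact this.comp_measurable (by fun_prop)
  calc _ ≤ ∫ p, (1/2) * (h p.1 ^ 2 + h (c • p.1 + s • p.2) ^ 2) ∂(gm2 n) := by
        refine integral_mono (intg_1 hh hh c s) ((J1.add J2).const_mul _) fun p => ?_
        simp only
        nlinarith [sq_nonneg (h p.1 - h (c • p.1 + s • p.2))]
    _ = _ := by
        rw [integral_const_mul, integral_add J1 J2, int_fst hsq, int_rot hsq c s hcs]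
        ring

lemma fderiv_sum {n : ℕ} (g : (Fin n → ℝ) → ℝ) (x v) : fderiv ℝ g x v = ∑ i, v i * pd i g x := by
  conv_lhs => rw [← Finset.univ_sum_single v]
  rw [map_sum]
  refine Finset.sum_congr rfl fun i _ => ?_
  have : Pi.single i (v i) = v i • (Pi.single i 1 : Fin n → ℝ) := by
    rw [← Pi.single_smul]; simp
  rw [this, map_smul, smul_eq_mul, pd]

lemma phi_deriv {n : ℕ} {g : (Fin n → ℝ) → ℝ} (hg : S g) (θ : ℝ) :
    HasDerivAt (fun θ : ℝ => ∫ p, g p.1 * g (Real.cos θ • p.1 + Real.sin θ • p.2) ∂(gm2 n))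
      (∫ p, g p.1 * ∑ i, (-Real.sin θ * p.1 i + Real.cos θ * p.2 i) * pd i g (Real.cos θ • p.1 + Real.sin θ • p.2) ∂(gm2 n)) θ := by
  obtain ⟨C, hC0, hC⟩ := hg.bdd
  choose D hD0 hD using fun i => (hg.pd i).bdd
  have hgc := hg.sm.continuous
  have hpc : ∀ i, Continuous (pd i g) := fun i => (hg.pd i).sm.continuous
  refine (hasDerivAt_integral_of_dominated_loc_of_deriv_le
    (F := fun (θ : ℝ) (p : (Fin n → ℝ) × (Fin n → ℝ)) => g p.1 * g (Real.cos θ • p.1 + Real.sin θ • p.2))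
    (F' := fun (θ : ℝ) (p : (Fin n → ℝ) × (Fin n → ℝ)) => g p.1 * ∑ i, (-Real.sin θ * p.1 i + Real.cos θ * p.2 i) * pd i g (Real.cos θ • p.1 + Real.sin θ • p.2))
    (bound := fun p => C * ∑ i, (|p.1 i| + |p.2 i|) * D i) (s := Set.univ) Filter.univ_mem ?_ ?_ ?_ ?_ ?_ ?_).2
  · exact .of_forall fun t => Continuous.aestronglyMeasurable (by fun_prop)
  · exact intg_1 hg hg _ _
  · exact Continuous.aestronglyMeasurable (by fun_prop)
  · refine .of_forall fun p t _ => ?_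
    rw [norm_mul]
    refine mul_le_mul (hC _) ?_ (norm_nonneg _) hC0
    refine (norm_sum_le _ _).trans (Finset.sum_le_sum fun i _ => ?_)
    rw [norm_mul]
    refine mul_le_mul ?_ (hD i _) (norm_nonneg _) (by positivity)
    refine (norm_add_le _ _).trans (add_le_add ?_ ?_)
    · rw [norm_mul, norm_neg]
      exact mul_le_of_le_one_left (abs_nonneg _) (Real.abs_sin_le_one t)
    · rw [norm_mul]
      exact mul_le_of_le_one_left (abs_nonneg _) (Real.abs_cos_le_one t)
  · exact (integrable_finsetSum _ fun i _ => ((intg_fst i).abs.add (intg_snd i).abs).mul_const _).const_mul _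
  · refine .of_forall fun p t _ => ?_
    have h1 : HasDerivAt (fun t : ℝ => Real.cos t • p.1 + Real.sin t • p.2) (-Real.sin t • p.1 + Real.cos t • p.2) t :=
      ((Real.hasDerivAt_cos t).smul_const p.1).add ((Real.hasDerivAt_sin t).smul_const p.2)
    have h2 := ((hg.diff (Real.cos t • p.1 + Real.sin t • p.2)).hasFDerivAt.comp_hasDerivAt t h1).const_mul (g p.1)
    rw [fderiv_sum] at h2
    simpa using h2

lemma phi_deriv_eq {n : ℕ} {g : (Fin n → ℝ) → ℝ} (hg : S g) (c : ℝ) {s : ℝ} (hs : s ≠ 0) :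
    ∫ p, g p.1 * ∑ i, (-s * p.1 i + c * p.2 i) * pd i g (c • p.1 + s • p.2) ∂(gm2 n)
      = - s * ∑ i, ∫ p, pd i g p.1 * pd i g (c • p.1 + s • p.2) ∂(gm2 n) := by
  have I1 : ∀ i, Integrable (fun p => -s * (p.1 i * (g p.1 * pd i g (c • p.1 + s • p.2)))) (gm2 n) := fun i =>
    (intg_k hg (hg.pd i) c s (intg_fst i)).const_mul _
  have I2 : ∀ i, Integrable (fun p => c * (p.2 i * (g p.1 * pd i g (c • p.1 + s • p.2)))) (gm2 n) := fun i =>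
    (intg_k hg (hg.pd i) c s (intg_snd i)).const_mul _
  have e : ∀ p : (Fin n → ℝ) × (Fin n → ℝ), g p.1 * ∑ i, (-s * p.1 i + c * p.2 i) * pd i g (c • p.1 + s • p.2)
      = ∑ i, (-s * (p.1 i * (g p.1 * pd i g (c • p.1 + s • p.2))) + c * (p.2 i * (g p.1 * pd i g (c • p.1 + s • p.2)))) := by
    intro p; rw [Finset.mul_sum]; exact Finset.sum_congr rfl fun i _ => by ring
  simp_rw [e]
  have I3 : ∀ i, Integrable (fun p => -s * (p.1 i * (g p.1 * pd i g (c • p.1 + s • p.2))) + c * (p.2 i * (g p.1 * pd i g (c • p.1 + s • p.2)))) (gm2 n) :=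
    fun i => (I1 i).add (I2 i)
  rw [integral_finsetSum _ fun i _ => I3 i, Finset.mul_sum]
  refine Finset.sum_congr rfl fun i _ => ?_
  rw [integral_add (I1 i) (I2 i), integral_const_mul, integral_const_mul]
  have a := ibp_fst hg (hg.pd i) c s i
  have b := ibp_snd hg (hg.pd i) c hs i
  rw [a, b]
  ring

lemma poincare {n : ℕ} {g : (Fin n → ℝ) → ℝ} (hg : S g) :
    ∫ z, (g z - ∫ w, g w ∂(gm n)) ^ 2 ∂(gm n) ≤ ∫ z, ∑ i, (pd i g z) ^ 2 ∂(gm n) := by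
  rw [var_eq hg, integral_finsetSum _ fun i _ => ((hg.pd i).pow).int]
  set D := ∑ i, ∫ z, (pd i g z) ^ 2 ∂(gm n)
  let φ : ℝ → ℝ := fun θ => ∫ p, g p.1 * g (Real.cos θ • p.1 + Real.sin θ • p.2) ∂(gm2 n)
  have hd : ∀ θ, HasDerivAt (fun θ => φ θ - D * Real.cos θ) _ θ := fun θ =>
    (phi_deriv hg θ).sub ((Real.hasDerivAt_cos θ).const_mul D)
  have hm : MonotoneOn (fun θ => φ θ - D * Real.cos θ) (Set.Icc 0 (Real.pi / 2)) := by
    refine monotoneOn_of_deriv_nonneg (convex_Icc _ _) (fun x _ => (hd x).continuousAt.continuousWithinAt)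
      (fun x _ => (hd x).differentiableAt.differentiableWithinAt) fun x hx => ?_
    rw [interior_Icc] at hx
    have hs : 0 < Real.sin x := Real.sin_pos_of_pos_of_lt_pi hx.1 (by linarith [hx.2, Real.pi_pos])
    rw [(hd x).deriv, phi_deriv_eq hg _ hs.ne']
    have : ∑ i, ∫ p, pd i g p.1 * pd i g (Real.cos x • p.1 + Real.sin x • p.2) ∂(gm2 n) ≤ D :=
      Finset.sum_le_sum fun i _ => cs_bound (hg.pd i) _ _ (Real.cos_sq_add_sin_sq x)
    nlinarith
  have h := hm (Set.left_mem_Icc.2 (by positivity)) (Set.right_mem_Icc.2 (by positivity)) (by positivity : (0:ℝ) ≤ Real.pi / 2)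
  have h0 : φ 0 = ∫ z, g z ^ 2 ∂(gm n) := by
    have := hg.sm.continuous
    rw [← int_fst (by fun_prop)]
    simp [φ, sq]
  have h1 : φ (Real.pi / 2) = (∫ z, g z ∂(gm n)) ^ 2 := by
    simp only [φ, Real.cos_pi_div_two, Real.sin_pi_div_two, zero_smul, one_smul, zero_add]
    rw [integral_prod_mul, sq]
  simp only [h0, h1, Real.cos_zero, Real.cos_pi_div_two] at h
  linarith

end VIG

/-- Variance identity and upper bound for `zᵀf(z) - div f(z) - g(z)`, `z ~ N(0, I_n)`:
`Var = E[‖f - ∇g‖² + tr((∇f)²)] + Var(g) - E[‖∇g‖²]`, and by the Gaussian Poincaré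
inequality, `Var ≤ E[‖f - ∇g‖² + tr((∇f)²)]`. -/
theorem variance_identity_general (n : ℕ)
    (f : (Fin n → ℝ) → (Fin n → ℝ)) (g : (Fin n → ℝ) → ℝ)
    (hf : ContDiff ℝ (⊤ : ℕ∞) f) (hfsupp : HasCompactSupport f)
    (hg : ContDiff ℝ (⊤ : ℕ∞) g) (hgsupp : HasCompactSupport g) :
    let μ : Measure (Fin n → ℝ) := Measure.pi fun _ : Fin n => gaussianReal 0 1
    let X : (Fin n → ℝ) → ℝ := fun z =>
      (∑ i, z i * f z i) - (∑ i, fderiv ℝ (fun y => f y i) z (Pi.single i 1)) - g z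
    let R : ℝ := ∫ z, ((∑ i, (f z i - fderiv ℝ g z (Pi.single i 1)) ^ 2) +
        ∑ i, ∑ j, fderiv ℝ (fun y => f y i) z (Pi.single j 1) *
          fderiv ℝ (fun y => f y j) z (Pi.single i 1)) ∂μ
    (∫ z, (X z - ∫ w, X w ∂μ) ^ 2 ∂μ) =
        R + ((∫ z, (g z - ∫ w, g w ∂μ) ^ 2 ∂μ) -
          ∫ z, ∑ i, (fderiv ℝ g z (Pi.single i 1)) ^ 2 ∂μ) ∧
      (∫ z, (X z - ∫ w, X w ∂μ) ^ 2 ∂μ) ≤ R := by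
  intro μ X R
  have hf' : ∀ i, VIG.S (fun y => f y i) := fun i =>
    ⟨contDiff_pi.1 hf i, hfsupp.comp_left (g := fun v : Fin n → ℝ => v i) rfl⟩
  have hg' : VIG.S g := ⟨hg, hgsupp⟩
  have hX : X = fun z => VIG.dl (fun i y => f y i) z - g z := by
    funext z
    simp only [X, VIG.dl, Finset.sum_sub_distrib, VIG.pd]
  have h1 := VIG.ident hf' hg'
  have h2 := VIG.poincare hg'
  have h3 : (∫ z, (X z - ∫ w, X w ∂μ) ^ 2 ∂μ) =
        R + ((∫ z, (g z - ∫ w, g w ∂μ) ^ 2 ∂μ) -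
          ∫ z, ∑ i, (fderiv ℝ g z (Pi.single i 1)) ^ 2 ∂μ) := by
    rw [hX]; exact h1
  refine ⟨h3, ?_⟩
  have h4 : (∫ z, (g z - ∫ w, g w ∂μ) ^ 2 ∂μ) ≤
          ∫ z, ∑ i, (fderiv ℝ g z (Pi.single i 1)) ^ 2 ∂μ := h2
  rw [h3]
  linarith
end

section
/- Let z ~ N(0, I_n) and f : ℝⁿ → ℝⁿ be smooth with compact support. Then Var(div f(z)) ≤ E[tr((∇f(z))²)] + E[‖(∇f(z)) z‖²]. -/
open MeasureTheory ProbabilityTheory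

noncomputable def gam (n : ℕ) : Measure (Fin n → ℝ) := Measure.pi fun _ : Fin n => gaussianReal 0 1

instance gam_prob (n : ℕ) : IsProbabilityMeasure (gam n) := by unfold gam; infer_instance

instance gam_gauss (n : ℕ) : IsGaussian (gam n) := by
  have h : gam n = (stdGaussian (EuclideanSpace ℝ (Fin n))).map
      (PiLp.continuousLinearEquiv 2 ℝ (fun _ : Fin n => ℝ)).toContinuousLinearMap := by
    rw [← map_pi_eq_stdGaussian, Measure.map_map (by fun_prop) (by fun_prop)]
    exact Measure.map_id.symm
  rw [h]; infer_instance

lemma gam_mean (n : ℕ) : (gam n)[id] = 0 := by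
  have hi : Integrable id (gam n) := IsGaussian.integrable_id
  funext i
  have := (ContinuousLinearMap.proj (R := ℝ) (φ := fun _ : Fin n => ℝ) i).integral_comp_comm hi
  simp only [ContinuousLinearMap.proj_apply] at this
  rw [← this]
  simp only [id, gam]
  rw [integral_comp_eval (μ := fun _ : Fin n => gaussianReal 0 1) (i := i) (f := fun x : ℝ => x) (by fun_prop)]
  simp

noncomputable def rho (n : ℕ) (z : Fin n → ℝ) : ℝ := ∏ i, gaussianPDFReal 0 1 (z i)

lemma rho_nonneg (n : ℕ) (z) : 0 ≤ rho n z := Finset.prod_nonneg fun _ _ => gaussianPDFReal_nonneg _ _ _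

lemma gam_density (n : ℕ) : gam n = volume.withDensity (fun z => ENNReal.ofReal (rho n z)) := by
  apply Measure.pi_eq
  intro s hs
  have hint : ∀ t : Set ℝ, MeasurableSet t → Integrable (t.indicator (gaussianPDFReal 0 1)) :=
    fun t ht => (integrable_gaussianPDFReal 0 1).indicator ht
  have h1 : ∀ i, gaussianReal 0 1 (s i) = ENNReal.ofReal (∫ x, (s i).indicator (gaussianPDFReal 0 1) x) := by
    intro i
    rw [gaussianReal_apply_eq_integral _ (by simp), integral_indicator (hs i)]
  simp_rw [h1]
  rw [← ENNReal.ofReal_prod_of_nonneg, ← integral_fintype_prod_volume_eq_prod (fun i => (s i).indicator (gaussianPDFReal 0 1)),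
    withDensity_apply _ (MeasurableSet.univ_pi hs), ← lintegral_indicator (MeasurableSet.univ_pi hs), ofReal_integral_eq_lintegral_ofReal]
  · congr 1
    funext z
    classical
    by_cases hz : z ∈ Set.univ.pi s
    · rw [Set.indicator_of_mem hz, rho]
      congr 1
      refine Finset.prod_congr rfl fun i _ => ?_
      rw [Set.indicator_of_mem (hz i trivial)]
    · rw [Set.indicator_of_notMem hz]
      simp only [Set.mem_pi, Set.mem_univ, true_imp_iff, not_forall] at hz
      obtain ⟨i, hi⟩ := hz
      rw [Finset.prod_eq_zero (Finset.mem_univ i) (Set.indicator_of_notMem hi _)]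
      simp
  · exact Integrable.fintype_prod (fun i => hint _ (hs i))
  · exact ae_of_all _ fun z => Finset.prod_nonneg fun i _ => Set.indicator_nonneg (fun _ _ => gaussianPDFReal_nonneg _ _ _) _
  · exact fun i _ => integral_nonneg fun x => Set.indicator_nonneg (fun _ _ => gaussianPDFReal_nonneg _ _ _) _

lemma rho_eq (n : ℕ) : ∃ c : ℝ, rho n = fun z => c * Real.exp (-(∑ i, z i ^ 2) / 2) := by
  refine ⟨∏ _i : Fin n, (√(2 * Real.pi * (1:NNReal)))⁻¹, ?_⟩
  funext z
  simp only [rho, gaussianPDFReal]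
  rw [Finset.prod_mul_distrib, ← Real.exp_sum]
  congr 2
  rw [← Finset.sum_neg_distrib, Finset.sum_div]
  simp

noncomputable def pd {n : ℕ} (i : Fin n) (h : (Fin n → ℝ) → ℝ) (z : Fin n → ℝ) : ℝ :=
  fderiv ℝ h z (Pi.single i 1)

lemma rho_smooth (n : ℕ) : ContDiff ℝ (⊤ : ℕ∞) (rho n) := by
  obtain ⟨c, hc⟩ := rho_eq n
  rw [hc]; fun_prop

lemma pd_rho (n : ℕ) (i : Fin n) (z) : pd i (rho n) z = - z i * rho n z := by
  obtain ⟨c, hc⟩ := rho_eq n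
  rw [hc, pd]
  have h1 : ∀ j : Fin n, HasFDerivAt (fun z : Fin n → ℝ => z j) (ContinuousLinearMap.proj (R := ℝ) (φ := fun _ : Fin n => ℝ) j) z :=
    fun j => (ContinuousLinearMap.proj (R := ℝ) (φ := fun _ : Fin n => ℝ) j).hasFDerivAt
  have h2 := (((HasFDerivAt.fun_sum (u := Finset.univ) (fun j _ => (h1 j).pow 2)).neg.mul_const (1/2 : ℝ)).exp.const_mul c)
  have h3 := h2.congr_of_eventuallyEq (f₁ := fun z : Fin n → ℝ => c * Real.exp (-(∑ i, z i ^ 2) / 2)) (Filter.Eventually.of_forall (by intro z; simp [div_eq_mul_inv]))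
  rw [h3.fderiv]
  simp [Pi.single_apply]
  simp only [div_eq_mul_inv]
  ring_nf

structure Test {n : ℕ} (h : (Fin n → ℝ) → ℝ) : Prop where
  smooth : ContDiff ℝ (⊤ : ℕ∞) h
  supp : HasCompactSupport h

lemma Test.diff {n : ℕ} {h : (Fin n → ℝ) → ℝ} (H : Test h) : Differentiable ℝ h :=
  H.smooth.differentiable (by simp)

lemma smooth_pd {n : ℕ} {h : (Fin n → ℝ) → ℝ} (H : ContDiff ℝ (⊤ : ℕ∞) h) (i : Fin n) : ContDiff ℝ (⊤ : ℕ∞) (pd i h) := by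
  have : ContDiff ℝ (⊤ : ℕ∞) (fderiv ℝ h) := H.fderiv_right (by simp)
  exact this.clm_apply contDiff_const

lemma Test.pd {n : ℕ} {h : (Fin n → ℝ) → ℝ} (H : Test h) (i : Fin n) : Test (pd i h) :=
  ⟨smooth_pd H.smooth i, H.supp.fderiv_apply ℝ (Pi.single i 1)⟩

lemma Test.mul_left {n : ℕ} {h k : (Fin n → ℝ) → ℝ} (H : Test h) (K : ContDiff ℝ (⊤ : ℕ∞) k) :
    Test (fun z => k z * h z) := ⟨K.mul H.smooth, H.supp.mul_left⟩

lemma Test.mul {n : ℕ} {h k : (Fin n → ℝ) → ℝ} (H : Test h) (K : Test k) :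
    Test (fun z => h z * k z) := K.mul_left H.smooth

lemma Test.sum {n : ℕ} {ι : Type*} [Fintype ι] {h : ι → (Fin n → ℝ) → ℝ} (H : ∀ i, Test (h i)) :
    Test (fun z => ∑ i, h i z) := by
  refine ⟨ContDiff.sum fun i _ => (H i).smooth, ?_⟩
  classical
  have : ∀ s : Finset ι, HasCompactSupport (fun z => ∑ i ∈ s, h i z) := by
    intro s
    induction s using Finset.induction_on with
    | empty => simp only [Finset.sum_empty]; exact HasCompactSupport.zero
    | insert a s ha ih => simp_rw [Finset.sum_insert ha]; exact (H a).supp.add ih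
  exact this _

lemma Test.coord {n : ℕ} {h : (Fin n → ℝ) → ℝ} (H : Test h) (i : Fin n) : Test (fun z => z i * h z) :=
  H.mul_left (contDiff_apply ℝ ℝ i)

lemma Test.integrable {n : ℕ} {h : (Fin n → ℝ) → ℝ} (H : Test h) (μ : Measure (Fin n → ℝ)) [IsFiniteMeasureOnCompacts μ] :
    Integrable h μ := H.smooth.continuous.integrable_of_hasCompactSupport H.supp

lemma integral_gam (n : ℕ) (h : (Fin n → ℝ) → ℝ) : ∫ z, h z ∂gam n = ∫ z, rho n z * h z := by
  rw [gam_density, integral_withDensity_eq_integral_toReal_smul]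
  · simp [ENNReal.toReal_ofReal (rho_nonneg n _)]
  · have := (rho_smooth n).continuous.measurable
    fun_prop
  · simp

lemma ibp {n : ℕ} {h : (Fin n → ℝ) → ℝ} (H : Test h) (i : Fin n) :
    ∫ z, z i * h z ∂gam n = ∫ z, pd i h z ∂gam n := by
  rw [integral_gam, integral_gam]
  have h1 : Integrable (fun x => fderiv ℝ (rho n) x (Pi.single i 1) * h x) volume :=
    (H.mul_left (smooth_pd (rho_smooth n) i)).integrable _
  have h2 : Integrable (fun x => rho n x * fderiv ℝ h x (Pi.single i 1)) volume :=
    ((H.pd i).mul_left (rho_smooth n)).integrable _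
  have h3 : Integrable (fun x => rho n x * h x) volume :=
    (H.mul_left (rho_smooth n)).integrable _
  have := integral_mul_fderiv_eq_neg_fderiv_mul_of_integrable h1 h2 h3
    (fun x _ => (rho_smooth n).differentiable (by simp) x) (fun x _ => H.diff x)
  unfold pd
  rw [this, ← integral_neg]
  congr 1
  funext z
  have := pd_rho n i z
  unfold pd at this
  rw [this]; ring


lemma Test.bound {n : ℕ} {h : (Fin n → ℝ) → ℝ} (H : Test h) : ∃ C, ∀ z, ‖h z‖ ≤ C :=
  H.smooth.continuous.bounded_above_of_compact_support H.supp

lemma Test.fbound {n : ℕ} {h : (Fin n → ℝ) → ℝ} (H : Test h) : ∃ C, ∀ z, ‖fderiv ℝ h z‖ ≤ C :=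
  (H.smooth.continuous_fderiv (by simp)).bounded_above_of_compact_support (H.supp.fderiv ℝ)

lemma fderiv_eq_sum {n : ℕ} (h : (Fin n → ℝ) → ℝ) (u v : Fin n → ℝ) :
    fderiv ℝ h u v = ∑ i, v i * pd i h u := by
  conv_lhs => rw [pi_eq_sum_univ' v]
  simp [pd, map_sum]

lemma rot_integral {n : ℕ} (θ : ℝ) (k : (Fin n → ℝ) × (Fin n → ℝ) → ℝ) (hk : Continuous k) :
    ∫ p, k (Real.cos θ • p.1 + Real.sin θ • p.2, -Real.sin θ • p.1 + Real.cos θ • p.2) ∂((gam n).prod (gam n))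
      = ∫ p, k p ∂((gam n).prod (gam n)) := by
  have h := IsGaussian.map_rotation_eq_self (gam_mean n) θ
  conv_rhs => rw [← h]
  rw [integral_map (by fun_prop) hk.aestronglyMeasurable]
  rfl

lemma bdd_int {α : Type*} [MeasurableSpace α] [TopologicalSpace α] [OpensMeasurableSpace α] [SecondCountableTopology α]
    (μ : Measure α) [IsFiniteMeasure μ] {k : α → ℝ} (hk : Continuous k) (hb : ∃ C, ∀ z, ‖k z‖ ≤ C) : Integrable k μ := by
  obtain ⟨C, hC⟩ := hb
  exact Integrable.of_bound hk.aestronglyMeasurable C (ae_of_all _ hC)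

lemma int_norm_add (n : ℕ) : Integrable (fun p : (Fin n → ℝ) × (Fin n → ℝ) => ‖p.1‖ + ‖p.2‖) ((gam n).prod (gam n)) := by
  have hi : Integrable (fun x : Fin n → ℝ => ‖x‖) (gam n) := (IsGaussian.integrable_id (μ := gam n)).norm
  exact (hi.comp_fst (gam n)).add (hi.comp_snd (gam n))

lemma H_deriv {n : ℕ} {g : (Fin n → ℝ) → ℝ} (G : Test g) (θ : ℝ) :
    HasDerivAt (fun θ : ℝ => ∫ p, g p.1 * g (Real.cos θ • p.1 + Real.sin θ • p.2) ∂((gam n).prod (gam n)))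
      (∫ p, g p.1 * fderiv ℝ g (Real.cos θ • p.1 + Real.sin θ • p.2) (-Real.sin θ • p.1 + Real.cos θ • p.2)
        ∂((gam n).prod (gam n))) θ := by
  obtain ⟨C, hC⟩ := G.bound
  obtain ⟨C', hC'⟩ := G.fbound
  have gc := G.smooth.continuous
  have fc : Continuous (fderiv ℝ g) := G.smooth.continuous_fderiv (by simp)
  have C0 : 0 ≤ C := (norm_nonneg _).trans (hC 0)
  have C0' : 0 ≤ C' := (norm_nonneg _).trans (hC' 0)
  refine (hasDerivAt_integral_of_dominated_loc_of_deriv_le (s := Set.univ) (μ := (gam n).prod (gam n)) (F := fun (θ : ℝ) (p : (Fin n → ℝ) × (Fin n → ℝ)) => g p.1 * g (Real.cos θ • p.1 + Real.sin θ • p.2)) Filter.univ_mem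
    (bound := fun p : (Fin n → ℝ) × (Fin n → ℝ) => C * (C' * (‖p.1‖ + ‖p.2‖)))
    (F' := fun (θ : ℝ) (p : (Fin n → ℝ) × (Fin n → ℝ)) => g p.1 * fderiv ℝ g (Real.cos θ • p.1 + Real.sin θ • p.2) (-Real.sin θ • p.1 + Real.cos θ • p.2))
    (Filter.Eventually.of_forall fun θ => Continuous.aestronglyMeasurable (by fun_prop))
    (bdd_int _ (by fun_prop) ⟨C * C, fun p => ?_⟩)
    (Continuous.aestronglyMeasurable (by fun_prop)) (ae_of_all _ fun p θ _ => ?_)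
    (((int_norm_add n).const_mul C').const_mul C) (ae_of_all _ fun p θ _ => ?_)).2
  · rw [norm_mul]; gcongr <;> apply hC
  · rw [norm_mul]
    gcongr
    · exact hC _
    · refine (ContinuousLinearMap.le_opNorm _ _).trans ?_
      gcongr
      · exact hC' _
      · refine (norm_add_le _ _).trans ?_
        rw [norm_smul, norm_smul]
        gcongr
        · refine mul_le_of_le_one_left (norm_nonneg _) ?_
          rw [norm_neg]; exact Real.abs_sin_le_one _
        · exact mul_le_of_le_one_left (norm_nonneg _) (Real.abs_cos_le_one _)
  · have h1 : HasDerivAt (fun θ : ℝ => Real.cos θ • p.1 + Real.sin θ • p.2) (-Real.sin θ • p.1 + Real.cos θ • p.2) θ :=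
      ((Real.hasDerivAt_cos θ).smul_const _).add ((Real.hasDerivAt_sin θ).smul_const _)
    exact ((G.diff _).hasFDerivAt.comp_hasDerivAt θ h1).const_mul _

lemma Test.affine {n : ℕ} {g : (Fin n → ℝ) → ℝ} (G : Test g) (a : Fin n → ℝ) {s : ℝ} (hs : s ≠ 0) :
    Test (fun v => g (a + s • v)) := by
  refine ⟨G.smooth.comp (by fun_prop), ?_⟩
  have := G.supp.comp_homeomorph ((Homeomorph.smulOfNeZero s hs).trans (Homeomorph.addLeft a))
  exact this

lemma pd_affine {n : ℕ} {g : (Fin n → ℝ) → ℝ} (G : Test g) (a : Fin n → ℝ) (s : ℝ) (i : Fin n) (v) :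
    pd i (fun v => g (a + s • v)) v = s * pd i g (a + s • v) := by
  have h1 : HasFDerivAt (fun v : Fin n → ℝ => a + s • v) (s • ContinuousLinearMap.id ℝ (Fin n → ℝ)) v :=
    ((hasFDerivAt_id v).const_smul s).const_add a
  have h2 := (G.diff (a + s • v)).hasFDerivAt.comp v h1
  have h3 : fderiv ℝ (fun v => g (a + s • v)) v = _ := h2.fderiv
  rw [pd, h3]
  simp [pd]

lemma H_deriv_ge {n : ℕ} {g : (Fin n → ℝ) → ℝ} (G : Test g) (θ : ℝ) (hθ : 0 < Real.sin θ) :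
    -Real.sin θ * ∫ z, ∑ i, pd i g z ^ 2 ∂gam n ≤
      ∫ p, g p.1 * fderiv ℝ g (Real.cos θ • p.1 + Real.sin θ • p.2) (-Real.sin θ • p.1 + Real.cos θ • p.2)
        ∂((gam n).prod (gam n)) := by
  obtain ⟨C, hC⟩ := G.bound
  obtain ⟨C', hC'⟩ := G.fbound
  have gc := G.smooth.continuous
  have fc : Continuous (fderiv ℝ g) := G.smooth.continuous_fderiv (by simp)
  have C0 : 0 ≤ C := (norm_nonneg _).trans (hC 0)
  have C0' : 0 ≤ C' := (norm_nonneg _).trans (hC' 0)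
  have pc : ∀ i, Continuous (pd i g) := fun i => (G.pd i).smooth.continuous
  set s := Real.sin θ with hs
  set c := Real.cos θ with hc
  let k : (Fin n → ℝ) × (Fin n → ℝ) → ℝ := fun p => g (c • p.1 + (-s) • p.2) * fderiv ℝ g p.1 p.2
  have kc : Continuous k := by fun_prop
  have hk1 : ∫ p, g p.1 * fderiv ℝ g (c • p.1 + s • p.2) (-s • p.1 + c • p.2) ∂((gam n).prod (gam n))
      = ∫ p, k p ∂((gam n).prod (gam n)) := by
    rw [← rot_integral θ k kc]
    congr 1
    funext p
    simp only [k]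
    congr 2
    have h1 : s * s + c * c = 1 := by rw [← Real.sin_sq_add_cos_sq θ]; ring
    funext i
    simp only [← hs, ← hc, Pi.add_apply, Pi.smul_apply, smul_eq_mul]
    linear_combination (- p.1 i) * h1
  have kint : Integrable k ((gam n).prod (gam n)) := by
    refine Integrable.mono' (((int_norm_add n).const_mul C').const_mul C) kc.aestronglyMeasurable
      (ae_of_all _ fun p => ?_)
    rw [norm_mul]
    gcongr
    · exact hC _
    · refine (ContinuousLinearMap.le_opNorm _ _).trans ?_
      gcongr
      · exact hC' _
      · linarith [norm_nonneg p.1]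
  let q : (Fin n → ℝ) × (Fin n → ℝ) → ℝ := fun p => ∑ i, pd i g (c • p.1 + (-s) • p.2) * pd i g p.1
  have qc : Continuous q := by fun_prop
  let Q : (Fin n → ℝ) → ℝ := fun z => ∑ i, pd i g z ^ 2
  have QT : Test Q := by
    have := Test.sum (fun i => (G.pd i).mul (G.pd i))
    simpa only [← sq] using this
  have Qc : Continuous Q := QT.smooth.continuous
  have Qb := QT.bound
  have q1 : ∀ p, |q p| ≤ (Q (c • p.1 + (-s) • p.2) + Q p.1) / 2 := by
    intro p
    refine (Finset.abs_sum_le_sum_abs _ _).trans ?_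
    simp only [Q]
    rw [← Finset.sum_add_distrib, Finset.sum_div]
    refine Finset.sum_le_sum fun i _ => ?_
    rw [abs_le]
    constructor <;> nlinarith [sq_nonneg (pd i g (c • p.1 + (-s) • p.2) - pd i g p.1), sq_nonneg (pd i g (c • p.1 + (-s) • p.2) + pd i g p.1)]
  have Q1 : Integrable (fun p : (Fin n → ℝ) × (Fin n → ℝ) => Q (c • p.1 + (-s) • p.2)) ((gam n).prod (gam n)) :=
    bdd_int _ (by fun_prop) (by obtain ⟨B, hB⟩ := Qb; exact ⟨B, fun p => hB _⟩)
  have Q2 : Integrable (fun p : (Fin n → ℝ) × (Fin n → ℝ) => Q p.1) ((gam n).prod (gam n)) :=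
    bdd_int _ (by fun_prop) (by obtain ⟨B, hB⟩ := Qb; exact ⟨B, fun p => hB _⟩)
  have qint : Integrable q ((gam n).prod (gam n)) :=
    Integrable.mono' ((Q1.add Q2).div_const 2) qc.aestronglyMeasurable (ae_of_all _ q1)
  have hk2 : ∫ p, k p ∂((gam n).prod (gam n)) = -s * ∫ p, q p ∂((gam n).prod (gam n)) := by
    rw [integral_prod _ kint, integral_prod _ qint, ← integral_const_mul]
    congr 1
    funext u
    have T : Test (fun v => g (c • u + (-s) • v)) := G.affine (c • u) (neg_ne_zero.mpr hθ.ne')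
    have e1 : ∀ v, k (u, v) = ∑ i, pd i g u * (v i * g (c • u + (-s) • v)) := by
      intro v
      simp only [k]
      rw [fderiv_eq_sum, Finset.mul_sum]
      exact Finset.sum_congr rfl fun i _ => by ring
    have e2 : ∀ v, q (u, v) = ∑ i, pd i g u * pd i g (c • u + (-s) • v) := by
      intro v
      simp only [q]
      exact Finset.sum_congr rfl fun i _ => by ring
    simp_rw [e1, e2]
    rw [integral_finsetSum _ (fun i _ => ((T.coord i).integrable _).const_mul _),
      integral_finsetSum _ (fun i _ => (((G.pd i).affine (c • u) (neg_ne_zero.mpr hθ.ne')).integrable _).const_mul _),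
      Finset.mul_sum]
    refine Finset.sum_congr rfl fun i _ => ?_
    rw [integral_const_mul, integral_const_mul, ibp T i]
    simp_rw [pd_affine G]
    rw [integral_const_mul]; ring
  have hQ : ∫ p, q p ∂((gam n).prod (gam n)) ≤ ∫ z, Q z ∂gam n := by
    have a1 : ∫ p : (Fin n → ℝ) × (Fin n → ℝ), Q p.1 ∂((gam n).prod (gam n)) = ∫ z, Q z ∂gam n := by
      rw [integral_fun_fst]; simp
    have a2 : ∫ p : (Fin n → ℝ) × (Fin n → ℝ), Q (c • p.1 + (-s) • p.2) ∂((gam n).prod (gam n)) = ∫ z, Q z ∂gam n := by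
      rw [← a1, ← rot_integral (-θ) (fun p => Q p.1) (by fun_prop)]
      simp only [Real.cos_neg, Real.sin_neg, hs, hc]
    calc _ ≤ ∫ p, (Q (c • p.1 + (-s) • p.2) + Q p.1) / 2 ∂((gam n).prod (gam n)) :=
          integral_mono qint ((Q1.add Q2).div_const 2) fun p => (le_abs_self _).trans (q1 p)
      _ = _ := by rw [integral_div, integral_add Q1 Q2, a1, a2]; ring
  rw [hk1, hk2]
  have := mul_le_mul_of_nonneg_left hQ hθ.le
  simp only [Q] at this
  linarith

lemma poincare {n : ℕ} {g : (Fin n → ℝ) → ℝ} (G : Test g) :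
    ∫ z, g z ^ 2 ∂gam n - (∫ z, g z ∂gam n) ^ 2 ≤ ∫ z, ∑ i, pd i g z ^ 2 ∂gam n := by
  let H : ℝ → ℝ := fun θ : ℝ => ∫ p, g p.1 * g (Real.cos θ • p.1 + Real.sin θ • p.2) ∂((gam n).prod (gam n))
  set A := ∫ z, ∑ i, pd i g z ^ 2 ∂gam n with hA
  have hd : ∀ θ, HasDerivAt (fun θ => H θ - A * Real.cos θ) (_ - A * (- Real.sin θ)) θ := fun θ =>
    (H_deriv G θ).sub ((Real.hasDerivAt_cos θ).const_mul A)
  have hm : MonotoneOn (fun θ => H θ - A * Real.cos θ) (Set.Icc 0 (Real.pi / 2)) := by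
    refine monotoneOn_of_deriv_nonneg (convex_Icc _ _)
      (fun θ _ => (hd θ).continuousAt.continuousWithinAt)
      (fun θ _ => (hd θ).differentiableAt.differentiableWithinAt) fun θ h => ?_
    rw [interior_Icc] at h
    rw [(hd θ).deriv]
    have := H_deriv_ge G θ (Real.sin_pos_of_pos_of_lt_pi h.1 (by linarith [h.2, Real.pi_pos]))
    linarith
  have hp := Real.pi_pos
  have h := hm (Set.left_mem_Icc.mpr (by linarith)) (Set.right_mem_Icc.mpr (by linarith)) (by linarith)
  simp only [H, Real.cos_zero, Real.sin_zero, Real.cos_pi_div_two, Real.sin_pi_div_two, one_smul, zero_smul, add_zero, zero_add, mul_one, mul_zero, sub_zero] at h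
  rw [integral_prod_mul g g, integral_fun_fst (μ := gam n) (ν := gam n) (fun z => g z * g z)] at h
  simp only [probReal_univ, one_smul] at h
  simp only [sq]
  rw [← sq]
  nlinarith [h]

lemma pd_mul {n : ℕ} {h k : (Fin n → ℝ) → ℝ} (H : Differentiable ℝ h) (K : Differentiable ℝ k) (i : Fin n) (z) :
    pd i (fun z => h z * k z) z = h z * pd i k z + k z * pd i h z := by
  unfold pd
  rw [fderiv_fun_mul (H z) (K z)]
  simp

lemma pd_sum {n : ℕ} {ι : Type*} [Fintype ι] {h : ι → (Fin n → ℝ) → ℝ} (H : ∀ j, Differentiable ℝ (h j)) (i : Fin n) (z) :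
    pd i (fun z => ∑ j, h j z) z = ∑ j, pd i (h j) z := by
  unfold pd
  rw [fderiv_fun_sum (fun j _ => H j z)]
  simp

lemma pd_coord {n : ℕ} (i j : Fin n) (z) : pd i (fun z : Fin n → ℝ => z j) z = if j = i then 1 else 0 := by
  unfold pd
  have : HasFDerivAt (fun z : Fin n → ℝ => z j) (ContinuousLinearMap.proj (R := ℝ) (φ := fun _ : Fin n => ℝ) j) z :=
    (ContinuousLinearMap.proj (R := ℝ) (φ := fun _ : Fin n => ℝ) j).hasFDerivAt
  rw [this.fderiv]
  simp [Pi.single_apply]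

lemma pd_comm {n : ℕ} {h : (Fin n → ℝ) → ℝ} (H : Test h) (i j : Fin n) (z) :
    pd i (pd j h) z = pd j (pd i h) z := by
  have hd : Differentiable ℝ (fderiv ℝ h) := (H.smooth.fderiv_right (m := (⊤ : ℕ∞)) (by simp)).differentiable (by simp)
  have key : ∀ a b : Fin n, pd a (pd b h) z = fderiv ℝ (fderiv ℝ h) z (Pi.single a 1) (Pi.single b 1) := by
    intro a b
    have h1 : HasFDerivAt (pd b h) _ z := (hd z).hasFDerivAt.clm_apply (hasFDerivAt_const (Pi.single b (1:ℝ) : Fin n → ℝ) z)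
    rw [pd, h1.fderiv]
    simp
  rw [key, key]
  have := (H.smooth.contDiffAt (x := z)).isSymmSndFDerivAt (by
    rw [minSmoothness_of_isRCLikeNormedField]; exact WithTop.coe_le_coe.mpr (le_top : (2 : ℕ∞) ≤ ⊤))
  exact this _ _

lemma main_aux {n : ℕ} (F : Fin n → (Fin n → ℝ) → ℝ) (T : ∀ i, Test (F i)) :
    ∫ z, (∑ i, pd i (F i) z - ∫ w, ∑ i, pd i (F i) w ∂gam n) ^ 2 ∂gam n ≤
      ∫ z, ∑ i, ∑ j, pd j (F i) z * pd i (F j) z ∂gam n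
        + ∫ z, ∑ i, (∑ j, z j * pd i (F j) z) ^ 2 ∂gam n := by
  let D : (Fin n → ℝ) → ℝ := fun z => ∑ i, pd i (F i) z
  let G : (Fin n → ℝ) → ℝ := fun z => ∑ i, z i * F i z
  let w : Fin n → (Fin n → ℝ) → ℝ := fun i z => ∑ j, z j * pd i (F j) z
  have DT : Test D := Test.sum fun i => (T i).pd i
  have GT : Test G := Test.sum fun i => (T i).coord i
  have wT : ∀ i, Test (w i) := fun i => Test.sum fun j => ((T j).pd i).coord j
  -- Stein
  have stein : ∀ h, Test h → ∫ z, h z * G z ∂gam n - ∫ z, h z * D z ∂gam n = ∫ z, ∑ i, F i z * pd i h z ∂gam n := by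
    intro h hT
    have e1 : ∀ z, h z * G z = ∑ i, z i * (h z * F i z) := fun z => by
      simp only [G, Finset.mul_sum]; exact Finset.sum_congr rfl fun i _ => by ring
    have e2 : ∀ z, h z * D z = ∑ i, h z * pd i (F i) z := fun z => by
      simp only [D, Finset.mul_sum]
    simp_rw [e1, e2]
    rw [integral_finsetSum _ fun i _ => ((hT.mul (T i)).coord i).integrable _,
      integral_finsetSum _ fun i _ => (hT.mul ((T i).pd i)).integrable _,
      integral_finsetSum _ fun i _ => ((T i).mul (hT.pd i)).integrable _, ← Finset.sum_sub_distrib]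
    refine Finset.sum_congr rfl fun i _ => ?_
    rw [ibp (hT.mul (T i)) i]
    simp_rw [pd_mul hT.diff (T i).diff]
    rw [integral_add ((hT.mul ((T i).pd i)).integrable _) (((T i).mul (hT.pd i)).integrable _)]
    ring
  have mean : ∫ z, G z ∂gam n = ∫ z, D z ∂gam n := by
    simp only [G, D]
    rw [integral_finsetSum _ fun i _ => ((T i).coord i).integrable _,
      integral_finsetSum _ fun i _ => ((T i).pd i).integrable _]
    exact Finset.sum_congr rfl fun i _ => ibp (T i) i
  have pdG : ∀ i z, pd i G z = F i z + w i z := by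
    intro i z
    simp only [G, w]
    rw [pd_sum (fun j => ((T j).coord j).diff)]
    have : ∀ j, pd i (fun z => z j * F j z) z = z j * pd i (F j) z + F j z * (if j = i then 1 else 0) := by
      intro j
      rw [pd_mul (by fun_prop) (T j).diff, pd_coord]
    simp_rw [this]
    rw [Finset.sum_add_distrib, add_comm]
    simp
  have sG := stein G GT
  have sD := stein D DT
  have FF : Test (fun z => ∑ i, F i z * F i z) := Test.sum fun i => (T i).mul (T i)
  have Fw : Test (fun z => ∑ i, F i z * w i z) := Test.sum fun i => (T i).mul (wT i)
  have ww : Test (fun z => ∑ i, w i z ^ 2) := by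
    have := Test.sum fun i => (wT i).mul (wT i)
    simpa only [← sq] using this
  have tr : Test (fun z => ∑ i, ∑ j, pd j (F i) z * pd i (F j) z) :=
    Test.sum fun i => Test.sum fun j => ((T i).pd j).mul ((T j).pd i)
  have FD : Test (fun z => ∑ i, F i z * pd i D z) := Test.sum fun i => (T i).mul (DT.pd i)
  have sG' : ∫ z, ∑ i, F i z * pd i G z ∂gam n = ∫ z, ∑ i, F i z * F i z ∂gam n + ∫ z, ∑ i, F i z * w i z ∂gam n := by
    rw [← integral_add (FF.integrable _) (Fw.integrable _)]
    simp_rw [pdG, mul_add, Finset.sum_add_distrib]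
  have sD' : ∫ z, ∑ i, F i z * w i z ∂gam n = ∫ z, ∑ i, ∑ j, pd j (F i) z * pd i (F j) z ∂gam n
      + ∫ z, ∑ i, F i z * pd i D z ∂gam n := by
    have e1 : ∀ z, ∑ i, F i z * w i z = ∑ i, ∑ j, z j * (F i z * pd i (F j) z) := fun z => by
      simp only [w, Finset.mul_sum]
      exact Finset.sum_congr rfl fun i _ => Finset.sum_congr rfl fun j _ => by ring
    have e2 : ∀ z, ∑ i, ∑ j, pd j (F i) z * pd i (F j) z + ∑ i, F i z * pd i D z
        = ∑ i, ∑ j, pd j (fun z => F i z * pd i (F j) z) z := fun z => by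
      rw [← Finset.sum_add_distrib]
      refine Finset.sum_congr rfl fun i _ => ?_
      simp only [D]
      rw [pd_sum (fun j => ((T j).pd j).diff), Finset.mul_sum, ← Finset.sum_add_distrib]
      refine Finset.sum_congr rfl fun j _ => ?_
      rw [pd_mul (T i).diff ((T j).pd i).diff, pd_comm (T j) i j]
      ring
    rw [← integral_add (tr.integrable _) (FD.integrable _)]
    simp_rw [e1, e2]
    have t1 : ∀ i j, Test (fun z => F i z * pd i (F j) z) := fun i j => (T i).mul ((T j).pd i)
    rw [integral_finsetSum _ fun i _ => (Test.sum fun j => (t1 i j).coord j).integrable _,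
      integral_finsetSum _ fun i _ => (Test.sum fun j => (t1 i j).pd j).integrable _]
    refine Finset.sum_congr rfl fun i _ => ?_
    rw [integral_finsetSum _ fun j _ => ((t1 i j).coord j).integrable _,
      integral_finsetSum _ fun j _ => ((t1 i j).pd j).integrable _]
    exact Finset.sum_congr rfl fun j _ => ibp (t1 i j) j
  have P := poincare GT
  have eP : ∫ z, ∑ i, pd i G z ^ 2 ∂gam n = ∫ z, ∑ i, F i z * F i z ∂gam n
      + 2 * ∫ z, ∑ i, F i z * w i z ∂gam n + ∫ z, ∑ i, w i z ^ 2 ∂gam n := by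
    have i3 : Integrable (fun z => ∑ i, F i z * F i z + 2 * ∑ i, F i z * w i z) (gam n) :=
      (FF.integrable _).add ((Fw.integrable _).const_mul 2)
    rw [← integral_const_mul, ← integral_add (FF.integrable _) ((Fw.integrable _).const_mul 2),
      ← integral_add i3 (ww.integrable _)]
    congr 1
    funext z
    simp_rw [pdG, Finset.mul_sum, ← Finset.sum_add_distrib]
    exact Finset.sum_congr rfl fun i _ => by ring
  have var : ∫ z, (D z - ∫ w, D w ∂gam n) ^ 2 ∂gam n = ∫ z, D z * D z ∂gam n - (∫ w, D w ∂gam n) ^ 2 := by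
    set m := ∫ w, D w ∂gam n with hm
    have : ∀ z, (D z - m) ^ 2 = D z * D z - 2 * m * D z + m ^ 2 := fun z => by ring
    simp_rw [this]
    have i1 := (DT.mul DT).integrable (gam n)
    have i2 := (DT.integrable (gam n)).const_mul (2 * m)
    have i3 : Integrable (fun z => D z * D z - 2 * m * D z) (gam n) := i1.sub i2
    rw [integral_add i3 (integrable_const _), integral_sub i1 i2, integral_const_mul, ← hm]
    simp
    ring
  have comm : ∫ z, D z * G z ∂gam n = ∫ z, G z * D z ∂gam n := by simp_rw [mul_comm]
  have sq1 : ∫ z, G z ^ 2 ∂gam n = ∫ z, G z * G z ∂gam n := by simp_rw [sq]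
  rw [mean] at P
  change ∫ z, (D z - ∫ w, D w ∂gam n) ^ 2 ∂gam n ≤ _ + ∫ z, ∑ i, w i z ^ 2 ∂gam n
  rw [var]
  linarith


/-- Variance bound for the divergence: for `z ~ N(0, I_n)` and `f : ℝⁿ → ℝⁿ` smooth with
compact support, `Var(div f(z)) ≤ E[tr((∇f(z))²)] + E[‖(∇f(z)) z‖²]`, where
`((∇f(z)) z)_i = ∑_j z_j ∂f_j/∂x_i (z)`. -/
theorem variance_divergence_bound (n : ℕ)
    (f : (Fin n → ℝ) → (Fin n → ℝ))
    (hf : ContDiff ℝ (⊤ : ℕ∞) f) (hfsupp : HasCompactSupport f) :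
    let μ : Measure (Fin n → ℝ) := Measure.pi fun _ : Fin n => gaussianReal 0 1
    let D : (Fin n → ℝ) → ℝ := fun z =>
      ∑ i, fderiv ℝ (fun y => f y i) z (Pi.single i 1)
    (∫ z, (D z - ∫ w, D w ∂μ) ^ 2 ∂μ) ≤
      (∫ z, ∑ i, ∑ j, fderiv ℝ (fun y => f y i) z (Pi.single j 1) *
          fderiv ℝ (fun y => f y j) z (Pi.single i 1) ∂μ) +
        ∫ z, ∑ i, (∑ j, z j * fderiv ℝ (fun y => f y j) z (Pi.single i 1)) ^ 2 ∂μ := by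
  have T : ∀ i, Test (fun y => f y i) := fun i =>
    ⟨(contDiff_pi.mp hf) i, hfsupp.comp_left (g := fun v : Fin n → ℝ => v i) rfl⟩
  exact main_aux (fun i y => f y i) T
end
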